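/- Let p > 2 and set z* = (1/(p−1))^(1/(p−2)) ∈ (0,1) (the unique positive zero of f''). Then g(t) < 0 for every t ∈ (0, z*]. -/

import Mathlib

/-- `f(t) = t²/2 - tᵖ/p`. -/
noncomputable def f (p t : ℝ) : ℝ := t ^ 2 / 2 - t ^ p / p

/-- First derivative: `f'(t) = t - t^(p-1)`. -/
noncomputable def f' (p t : ℝ) : ℝ := t - t ^ (p - 1)

/-- Second derivative: `f''(t) = 1 - (p-1) t^(p-2)`. -/
noncomputable def f'' (p t : ℝ) : ℝ := 1 - (p - 1) * t ^ (p - 2)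

/-- Third derivative: `f'''(t) = -(p-1)(p-2) t^(p-3)`. -/
noncomputable def f''' (p t : ℝ) : ℝ := -(p - 1) * (p - 2) * t ^ (p - 3)

/-- `g(t) = -3 f''(t) f'(t)² + 6 (f(t)-f(1)) f''(t)² - 2 (f(t)-f(1)) f'''(t) f'(t)`. -/
noncomputable def g (p t : ℝ) : ℝ :=
  -3 * f'' p t * (f' p t) ^ 2 + 6 * (f p t - f p 1) * (f'' p t) ^ 2
    - 2 * (f p t - f p 1) * f''' p t * f' p t

theorem f_lt_f_one {p t : ℝ} (hp : 2 < p) (ht : 0 < t) (ht1 : t < 1) : f p t < f p 1 := by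
  have hp0 : 0 < p := by linarith
  -- Bernoulli inequality for `(t²)^(p/2)`
  have hB := one_add_mul_self_lt_rpow_one_add (s := t ^ 2 - 1) (p := p / 2)
    (by nlinarith) (by nlinarith) (by linarith)
  have hpow : (1 + (t ^ 2 - 1)) ^ (p / 2) = t ^ p := by
    rw [add_sub_cancel, ← Real.rpow_natCast, ← Real.rpow_mul ht.le]
    congr 1
    push_cast
    ring
  rw [hpow] at hB
  have hdiv := div_lt_div_of_pos_right hB hp0
  have hsplit : (1 + p / 2 * (t ^ 2 - 1)) / p = 1 / p + (t ^ 2 - 1) / 2 := by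
    field_simp
  rw [hsplit] at hdiv
  simp only [f, Real.one_rpow]
  linarith

/-- let `p > 2` and `z* = (1/(p-1))^(1/(p-2)) ∈ (0,1)`. Then `g(t) < 0` for
every `t ∈ (0, z*]`. -/
theorem stmt_10 (p : ℝ) (hp : 2 < p) (t : ℝ)
    (ht : t ∈ Set.Ioc (0 : ℝ) ((1 / (p - 1)) ^ (1 / (p - 2)))) :
    g p t < 0 := by
  obtain ⟨ht0, htz⟩ := ht
  have hz1 : (1 / (p - 1)) ^ (1 / (p - 2)) < 1 :=
    Real.rpow_lt_one (one_div_pos.2 (by linarith)).le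
      ((div_lt_one (by linarith)).2 (by linarith)) (one_div_pos.2 (by linarith))
  have ht1 : t < 1 := htz.trans_lt hz1
  have hpow : t ^ (p - 2) ≤ 1 / (p - 1) := by
    have h := Real.rpow_le_rpow ht0.le htz (by linarith : 0 ≤ p - 2)
    rwa [← Real.rpow_mul (one_div_pos.2 (by linarith)).le,
      one_div_mul_cancel (by linarith), Real.rpow_one] at h
  have hf'' : 0 ≤ f'' p t := by
    rw [le_div_iff₀ (by linarith)] at hpow
    simp only [f'']
    linarith
  have hf' : 0 < f' p t := by
    have h := Real.rpow_lt_rpow_of_exponent_gt ht0 ht1 (by linarith : 1 < p - 1)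
    rw [Real.rpow_one] at h
    exact sub_pos.2 h
  have hf''' : f''' p t < 0 := by
    have h := mul_pos (mul_pos (by linarith : 0 < p - 1) (by linarith : 0 < p - 2))
      (Real.rpow_pos_of_pos ht0 (p - 3))
    simp only [f''']
    linarith
  have hD : 0 < f p 1 - f p t := sub_pos.2 (f_lt_f_one hp ht0 ht1)
  have h₁ := mul_nonneg hf'' (sq_nonneg (f' p t))
  have h₂ := mul_nonneg hD.le (sq_nonneg (f'' p t))
  have h₃ := mul_pos (mul_pos hD (neg_pos.2 hf''')) hf'
  simp only [g]
  linarith
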